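/- Let (X, d) be a separable metric space and μ a Borel probability measure on X with finite first moment and with d integrable with respect to μ ⊗ μ. Define the doubly centred distance d_μ(x,x') = d(x,x') − a_μ(x) − a_μ(x') + D(μ) where a_μ(x) = ∫ d(x,y) dμ(y) and D(μ) = ∫ a_μ dμ. Then the distance variance ∫∫ d_μ(x, x')² dμ(x) dμ(x') is nonnegative, and it equals 0 if and only if μ is a Dirac measure (i.e. μ is supported on a single point). -/

import Mathlib

open MeasureTheory

section

variable {X : Type*} [PseudoMetricSpace X] [MeasurableSpace X] {μ : Measure X}

/-- The expected distance to a random point is `1`-Lipschitz. -/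
theorem lipschitzWith_integral_dist [IsProbabilityMeasure μ]
    (hfm : ∀ x : X, Integrable (fun y => dist x y) μ) :
    LipschitzWith 1 fun x => ∫ y, dist x y ∂μ := by
  refine LipschitzWith.of_le_add fun x z => ?_
  calc ∫ y, dist x y ∂μ ≤ ∫ y, (dist z y + dist x z) ∂μ :=
        integral_mono (hfm x) ((hfm z).add (integrable_const _)) fun y => by
          simpa [add_comm] using dist_triangle x z y
    _ = (∫ y, dist z y ∂μ) + dist x z := by
        rw [integral_add (hfm z) (integrable_const _)]; simp

theorem dist_le_integral_dist_add [IsProbabilityMeasure μ]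
    (hfm : ∀ x : X, Integrable (fun y => dist x y) μ) (x z : X) :
    dist x z ≤ (∫ y, dist x y ∂μ) + ∫ y, dist z y ∂μ := by
  calc dist x z = ∫ _, dist x z ∂μ := by simp
    _ ≤ ∫ y, (dist x y + dist z y) ∂μ :=
        integral_mono (integrable_const _) ((hfm x).add (hfm z)) fun y =>
          dist_triangle_right x z y
    _ = _ := integral_add (hfm x) (hfm z)

/-- The square of the doubly centred distance is dominated by a product of functions of each
variable; this gives square integrability from first moments only. -/
theorem sq_doublyCentered_le [IsProbabilityMeasure μ]
    (hfm : ∀ x : X, Integrable (fun y => dist x y) μ) {D : ℝ} (hD : 0 ≤ D) (x z : X) :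
    (dist x z - (∫ y, dist x y ∂μ) - (∫ y, dist z y ∂μ) + D) ^ 2 ≤
      (2 * (∫ y, dist x y ∂μ) + D) * (2 * (∫ y, dist z y ∂μ) + D) := by
  have h1 := (lipschitzWith_integral_dist hfm).dist_le_mul x z
  have h2 := dist_le_integral_dist_add hfm x z
  have hx : 0 ≤ ∫ y, dist x y ∂μ := integral_nonneg fun _ => dist_nonneg
  have hz : 0 ≤ ∫ y, dist z y ∂μ := integral_nonneg fun _ => dist_nonneg
  rw [Real.dist_eq, NNReal.coe_one, one_mul, abs_le] at h1
  rw [← sq_abs, sq]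
  refine mul_le_mul ?_ ?_ (abs_nonneg _) (by positivity) <;>
    exact abs_le.2 ⟨by linarith, by linarith⟩

/-- A continuous function vanishing almost everywhere for `μ.prod μ` vanishes on the diagonal
of the support of `μ`. -/
theorem apply_self_eq_zero_of_ae_prod_eq_zero [SFinite μ] {f : X × X → ℝ} (hf : Continuous f)
    (h : f =ᵐ[μ.prod μ] 0) {x : X} (hx : x ∈ μ.support) : f (x, x) = 0 := by
  by_contra hne
  obtain ⟨U, hU, V, hV, hUV⟩ := mem_nhds_prod_iff.1 ((hf.continuousAt).eventually_ne hne)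
  have h0 : μ.prod μ (U ×ˢ V) = 0 := measure_mono_null hUV h
  rw [Measure.prod_prod, mul_eq_zero] at h0
  rw [Measure.mem_support_iff_forall] at hx
  exact h0.elim (hx U hU).ne' (hx V hV).ne'

end

theorem eq_dirac_of_integral_dist_eq_zero {X : Type*} [MetricSpace X] [MeasurableSpace X]
    {μ : Measure X} [IsProbabilityMeasure μ] {x : X}
    (hx : Integrable (fun y => dist x y) μ) (h : ∫ y, dist x y ∂μ = 0) :
    μ = Measure.dirac x := by
  have hae : (id : X → X) =ᵐ[μ] fun _ => x := by
    filter_upwards [(integral_eq_zero_iff_of_nonneg (fun _ => dist_nonneg) hx).1 h] with y hy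
    exact (dist_eq_zero.1 hy).symm
  calc μ = μ.map id := Measure.map_id.symm
    _ = μ.map fun _ => x := Measure.map_congr hae
    _ = Measure.dirac x := by simp [Measure.map_const]

theorem distance_variance_nonneg_and_zero_iff_dirac
    {X : Type*} [MetricSpace X] [TopologicalSpace.SeparableSpace X]
    [MeasurableSpace X] [BorelSpace X]
    (μ : Measure X) [IsProbabilityMeasure μ]
    (hfm : ∀ x : X, Integrable (fun y => dist x y) μ)
    (hprod : Integrable (fun q : X × X => dist q.1 q.2) (μ.prod μ)) :
    let aμ : X → ℝ := fun x => ∫ y, dist x y ∂μ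
    let D : ℝ := ∫ x, aμ x ∂μ
    let dμ : X → X → ℝ := fun x x' => dist x x' - aμ x - aμ x' + D
    0 ≤ (∫ x, ∫ x', (dμ x x') ^ 2 ∂μ ∂μ) ∧
      ((∫ x, ∫ x', (dμ x x') ^ 2 ∂μ ∂μ) = 0 ↔ ∃ x₀ : X, μ = Measure.dirac x₀) := by
  intro aμ D dμ
  have : SecondCountableTopology X := UniformSpace.secondCountable_of_separable X
  refine ⟨integral_nonneg fun x => integral_nonneg fun y => sq_nonneg _, fun h => ?_, ?_⟩
  · have ha : Continuous aμ := (lipschitzWith_integral_dist hfm).continuous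
    have ha0 : ∀ x, 0 ≤ aμ x := fun x => integral_nonneg fun _ => dist_nonneg
    have hai : Integrable aμ μ := hprod.integral_prod_left
    have hd : Continuous fun q : X × X => dμ q.1 q.2 := by fun_prop
    have hb : Integrable (fun x => 2 * aμ x + D) μ := (hai.const_mul 2).add (integrable_const D)
    have hint : Integrable (fun q : X × X => dμ q.1 q.2 ^ 2) (μ.prod μ) := by
      refine (hb.mul_prod hb).mono' (hd.pow 2).aestronglyMeasurable (.of_forall fun q => ?_)
      rw [Real.norm_of_nonneg (sq_nonneg _)]
      exact sq_doublyCentered_le hfm (integral_nonneg ha0) q.1 q.2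
    rw [integral_integral hint, integral_eq_zero_iff_of_nonneg (fun _ => sq_nonneg _) hint] at h
    have hdiag : ∀ᵐ x ∂μ, aμ x = D / 2 := by
      filter_upwards [Measure.support_mem_ae] with x hx
      have := pow_eq_zero_iff two_ne_zero |>.1
        (apply_self_eq_zero_of_ae_prod_eq_zero (hd.pow 2) h hx)
      simp only [dμ, dist_self] at this
      linarith
    have hD : D = D / 2 := by
      simpa using integral_congr_ae hdiag
    obtain ⟨x, hx⟩ := hdiag.exists
    exact ⟨x, eq_dirac_of_integral_dist_eq_zero (hfm x) (by change aμ x = 0; linarith)⟩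
  · rintro ⟨x₀, h⟩
    simp [dμ, D, aμ, h]
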